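/- Let n ≥ 1 and d ≥ 1, and let A = (V,R) be a finite n-ary structure. There exists a homomorphism from A to the n-ary cycle C_d^n if and only if d divides γ(A*). -/

import Mathlib

/-- A finite digraph: a number of vertices together with an edge relation on `Fin n`. -/
abbrev FinDigraph := Σ n : ℕ, (Fin n → Fin n → Prop)

/-- `f` is a homomorphism of digraphs from `A` to `B`. -/
def IsHom (A B : FinDigraph) (f : Fin A.1 → Fin B.1) : Prop :=
  ∀ a b : Fin A.1, A.2 a b → B.2 (f a) (f b)

/-- The number of homomorphisms from `A` to `B`. -/
noncomputable def homN (A B : FinDigraph) : ℕ :=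
  Nat.card {f : Fin A.1 → Fin B.1 // IsHom A B f}
/-- An oriented walk in a digraph `A`, with `len` steps: vertices `vert 0, …, vert len`
and signs `sign 0, …, sign (len-1)`, where a `true` sign is a forward edge and a
`false` sign is a backward edge. -/
structure OWalk (A : FinDigraph) where
  len : ℕ
  vert : ℕ → Fin A.1
  sign : ℕ → Bool
  valid : ∀ i < len,
    (sign i = true → A.2 (vert i) (vert (i + 1))) ∧
    (sign i = false → A.2 (vert (i + 1)) (vert i))

/-- The net length of an oriented walk: number of forward steps minus number of
backward steps. -/
def OWalk.netLength {A : FinDigraph} (W : OWalk A) : ℤ :=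
  (((Finset.range W.len).filter fun i => W.sign i = true).card : ℤ) -
  (((Finset.range W.len).filter fun i => W.sign i = false).card : ℤ)

/-- An oriented cycle: a closed oriented walk with at least one step whose vertices
(other than the repeated endpoint) are pairwise distinct. -/
def OWalk.IsCycle {A : FinDigraph} (W : OWalk A) : Prop :=
  0 < W.len ∧ W.vert W.len = W.vert 0 ∧
    ∀ i < W.len, ∀ j < W.len, W.vert i = W.vert j → i = j
/-- The gcd of a set of natural numbers: the number dividing all elements of `S`
that is divisible by every common divisor of `S` (this is `0` when `S ⊆ {0}`). -/
noncomputable def setGcd (S : Set ℕ) : ℕ :=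
  sInf {d : ℕ | (∀ s ∈ S, d ∣ s) ∧ ∀ e : ℕ, (∀ s ∈ S, e ∣ s) → e ∣ d}

/-- `gamma A` is the gcd of the net lengths of all oriented cycles of positive net
length in `A` (`0` if there are none). -/
noncomputable def gamma (A : FinDigraph) : ℕ :=
  setGcd {m : ℕ | 0 < m ∧ ∃ W : OWalk A, W.IsCycle ∧ W.netLength = (m : ℤ)}
/-- The directed cycle `C_n` on vertex set `ℤ/nℤ` (represented as `Fin n`),
with edges `i → i+1 (mod n)`. -/
def cycleD (n : ℕ) : FinDigraph := ⟨n, fun i j => (i.val + 1) % n = j.val⟩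
/-- A finite `n`-ary structure: a finite domain `Fin v` together with an `n`-ary
relation on it (tuples modeled as `Fin n → Fin v`). -/
abbrev NStruct (n : ℕ) := Σ v : ℕ, ((Fin n → Fin v) → Prop)

/-- `f` is a homomorphism of `n`-ary structures from `A` to `B`. -/
def IsHomS {n : ℕ} (A B : NStruct n) (f : Fin A.1 → Fin B.1) : Prop :=
  ∀ t : Fin n → Fin A.1, A.2 t → B.2 (f ∘ t)

/-- The `n`-ary cycle of length `d`: domain `ℤ/dℤ` (as `Fin d`) with relation
`{(i, i+1, …, i+n-1) : i}` (arithmetic mod `d`). -/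
def naryCycle (n d : ℕ) : NStruct n :=
  ⟨d, fun t => ∃ i : Fin d, ∀ j : Fin n, (t j).val = (i.val + j.val) % d⟩

/-- The digraph `A*` associated to an `n`-ary structure `A`: an edge `a → b` whenever
some tuple of the relation of `A` has `a` and `b` as consecutive entries. -/
def star {n : ℕ} (A : NStruct n) : FinDigraph :=
  ⟨A.1, fun a b => ∃ (t : Fin n → Fin A.1) (i : Fin n) (h : i.val + 1 < n),
    A.2 t ∧ t i = a ∧ t ⟨i.val + 1, h⟩ = b⟩

theorem dvd_setGcd_iff (S : Set ℕ) (d : ℕ) : d ∣ setGcd S ↔ ∀ s ∈ S, d ∣ s := by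
  have hne : ({d : ℕ | (∀ s ∈ S, d ∣ s) ∧ ∀ e : ℕ, (∀ s ∈ S, e ∣ s) → e ∣ d}).Nonempty := by
    let I : Ideal ℤ := Ideal.span ((fun s : ℕ => (s : ℤ)) '' S)
    obtain ⟨g, hg⟩ := (IsPrincipalIdealRing.principal I).principal
    refine ⟨g.natAbs, ?_, ?_⟩
    · intro s hs
      have h1 : (s : ℤ) ∈ I := Ideal.subset_span ⟨s, hs, rfl⟩
      rw [hg] at h1
      have h2 : g ∣ (s : ℤ) := Ideal.mem_span_singleton.1 h1
      exact Int.natAbs_dvd_natAbs.2 h2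
    · intro e he
      have h1 : g ∈ I := by rw [hg]; exact Ideal.mem_span_singleton_self g
      have h2 : I ≤ Ideal.span {(e : ℤ)} := by
        refine Ideal.span_le.2 ?_
        rintro _ ⟨s, hs, rfl⟩
        exact Ideal.mem_span_singleton.2 (Int.natCast_dvd_natCast.2 (he s hs))
      have h3 := Ideal.mem_span_singleton.1 (h2 h1)
      exact Int.natCast_dvd.1 h3
  have := Nat.sInf_mem hne
  constructor
  · intro h s hs
    exact h.trans (this.1 s hs)
  · intro h
    exact this.2 d h

def sg (b : Bool) : ℤ := if b = true then 1 else -1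

theorem netLength_eq {A : FinDigraph} (W : OWalk A) :
    W.netLength = ∑ i ∈ Finset.range W.len, sg (W.sign i) := by
  unfold OWalk.netLength
  rw [Finset.natCast_card_filter, Finset.natCast_card_filter, ← Finset.sum_sub_distrib]
  refine Finset.sum_congr rfl fun i _ => ?_
  unfold sg
  cases W.sign i <;> simp

/-- closed walks have net length divisible by d -/
theorem closed_dvd {A : FinDigraph} (d : ℕ)
    (h : ∀ m : ℕ, 0 < m → (∃ W : OWalk A, W.IsCycle ∧ W.netLength = (m : ℤ)) → d ∣ m) :
    ∀ (N : ℕ) (W : OWalk A), W.len = N → W.vert W.len = W.vert 0 → (d : ℤ) ∣ W.netLength := by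
  intro N
  induction N using Nat.strong_induction_on with
  | _ N ih =>
  intro W hN hW
  by_cases hlen : W.len = 0
  · rw [netLength_eq, hlen]; simp
  by_cases hc : ∀ i < W.len, ∀ j < W.len, W.vert i = W.vert j → i = j
  · rcases lt_trichotomy W.netLength 0 with hlt | heq | hgt
    · let W' : OWalk A :=
        { len := W.len
          vert := fun k => W.vert (W.len - k)
          sign := fun k => ! W.sign (W.len - 1 - k)
          valid := by
            intro i hi
            have hv := W.valid (W.len - 1 - i) (by omega)
            have e1 : W.len - 1 - i + 1 = W.len - i := by omega
            have e2 : W.len - (i + 1) = W.len - 1 - i := by omega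
            rw [e1] at hv
            rw [e2]
            refine ⟨fun hs => hv.2 (by simpa using hs), fun hs => hv.1 (by simpa using hs)⟩ }
      have hnet : W'.netLength = - W.netLength := by
        rw [netLength_eq, netLength_eq, ← Finset.sum_range_reflect, ← Finset.sum_neg_distrib]
        refine Finset.sum_congr rfl fun i hi => ?_
        have hi' : i < W.len := Finset.mem_range.1 hi
        have e : W.len - 1 - (W.len - 1 - i) = i := by omega
        change sg (! W.sign (W.len - 1 - (W.len - 1 - i))) = _
        rw [e]
        cases W.sign i <;> simp [sg]
      have hcyc : W'.IsCycle := by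
        refine ⟨Nat.pos_of_ne_zero hlen, ?_, ?_⟩
        · change W.vert (W.len - W.len) = W.vert (W.len - 0)
          simp [hW]
        · intro i hi j hj hij
          change i < W.len at hi
          change j < W.len at hj
          change W.vert (W.len - i) = W.vert (W.len - j) at hij
          by_cases hi0 : i = 0
          · by_cases hj0 : j = 0
            · omega
            · subst hi0
              rw [Nat.sub_zero, hW] at hij
              have := hc _ (by omega) _ (by omega) hij
              omega
          · by_cases hj0 : j = 0
            · subst hj0
              rw [Nat.sub_zero, hW] at hij
              have := hc _ (by omega) _ (by omega) hij
              omega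
            · have := hc _ (by omega) _ (by omega) hij
              omega
      have := h W'.netLength.toNat (by omega) ⟨W', hcyc, by omega⟩
      have h2 : (d : ℤ) ∣ (W'.netLength.toNat : ℤ) := Int.natCast_dvd_natCast.2 this
      rw [Int.toNat_of_nonneg (by omega), hnet] at h2
      exact (dvd_neg).1 h2
    · rw [heq]; exact dvd_zero _
    · have := h W.netLength.toNat (by omega) ⟨W, ⟨Nat.pos_of_ne_zero hlen, hW, hc⟩, by omega⟩
      have h2 : (d : ℤ) ∣ (W.netLength.toNat : ℤ) := Int.natCast_dvd_natCast.2 this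
      rwa [Int.toNat_of_nonneg (by omega)] at h2
  · obtain ⟨i, j, hij, hj, hv⟩ : ∃ i j, i < j ∧ j < W.len ∧ W.vert i = W.vert j := by
      push Not at hc
      obtain ⟨i, hi, j, hj, hv, hne⟩ := hc
      rcases lt_or_gt_of_ne hne with hl | hl
      · exact ⟨i, j, hl, hj, hv⟩
      · exact ⟨j, i, hl, hi, hv.symm⟩
    obtain ⟨p, rfl⟩ : ∃ p, j = i + p := ⟨j - i, by omega⟩
    obtain ⟨q, hq⟩ : ∃ q, W.len = i + p + q := ⟨W.len - (i + p), by omega⟩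
    let W1 : OWalk A :=
      { len := p
        vert := fun k => W.vert (i + k)
        sign := fun k => W.sign (i + k)
        valid := fun k hk => W.valid (i + k) (by omega) }
    let W2 : OWalk A :=
      { len := i + q
        vert := fun k => if k ≤ i then W.vert k else W.vert (k + p)
        sign := fun k => if k < i then W.sign k else W.sign (k + p)
        valid := by
          intro k hk
          rcases lt_trichotomy k i with hl | he | hg
          · have := W.valid k (by omega)
            simpa [hl, hl.le, Nat.succ_le_of_lt hl] using this
          · subst he
            have := W.valid (k + p) (by omega)
            rw [← hv] at this
            have e : k + p + 1 = k + 1 + p := by omega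
            rw [e] at this
            simpa using this
          · have := W.valid (k + p) (by omega)
            have e : k + p + 1 = k + 1 + p := by omega
            rw [e] at this
            have h1 : ¬ k < i := by omega
            have h2 : ¬ k ≤ i := by omega
            have h3 : ¬ k + 1 ≤ i := by omega
            simpa only [h1, h2, h3, if_false] using this }
    have d1 := ih p (by omega) W1 rfl hv.symm
    have d2 := ih (i + q) (by omega) W2 rfl (by
      change (if i + q ≤ i then W.vert (i + q) else W.vert (i + q + p)) =
        (if 0 ≤ i then W.vert 0 else W.vert (0 + p))
      have h1 : ¬ i + q ≤ i := by omega
      have h2 : i + q + p = W.len := by omega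
      rw [if_neg h1, if_pos (Nat.zero_le _), h2, hW])
    have hs : W.netLength = W1.netLength + W2.netLength := by
      rw [netLength_eq, netLength_eq, netLength_eq, hq]
      change _ = ∑ k ∈ Finset.range p, sg (W.sign (i + k)) +
        ∑ k ∈ Finset.range (i + q), sg (if k < i then W.sign k else W.sign (k + p))
      rw [Finset.sum_range_add, Finset.sum_range_add, Finset.sum_range_add]
      have e1 : ∑ k ∈ Finset.range i, sg (if k < i then W.sign k else W.sign (k + p)) =
          ∑ k ∈ Finset.range i, sg (W.sign k) := by
        refine Finset.sum_congr rfl fun k hk => ?_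
        rw [if_pos (Finset.mem_range.1 hk)]
      have e2 : ∑ k ∈ Finset.range q, sg (if i + k < i then W.sign (i + k) else W.sign (i + k + p)) =
          ∑ k ∈ Finset.range q, sg (W.sign (i + p + k)) := by
        refine Finset.sum_congr rfl fun k hk => ?_
        rw [if_neg (by omega), Nat.add_right_comm]
      rw [e1, e2]; ring
    rw [hs]
    exact dvd_add d1 d2

inductive Reach (A : FinDigraph) (a : Fin A.1) : Fin A.1 → ℤ → Prop
  | nil : Reach A a a 0
  | fwd {b c : Fin A.1} {z : ℤ} : Reach A a b z → A.2 b c → Reach A a c (z + 1)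
  | bwd {b c : Fin A.1} {z : ℤ} : Reach A a b z → A.2 c b → Reach A a c (z - 1)

theorem Reach.trans {A : FinDigraph} {a b c : Fin A.1} {y z : ℤ} (h1 : Reach A a b y)
    (h2 : Reach A b c z) : Reach A a c (y + z) := by
  induction h2 with
  | nil => simpa using h1
  | fwd _ e ih => rw [← add_assoc]; exact ih.fwd e
  | bwd _ e ih => rw [← add_sub_assoc]; exact ih.bwd e

theorem Reach.symm {A : FinDigraph} {a b : Fin A.1} {z : ℤ} (h : Reach A a b z) :
    Reach A b a (-z) := by
  induction h with
  | nil => simpa using Reach.nil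
  | fwd _ e ih =>
    have := (Reach.nil.bwd e).trans ih
    convert this using 1; ring
  | bwd _ e ih =>
    have := (Reach.nil.fwd e).trans ih
    convert this using 1; ring

theorem snoc_walk {A : FinDigraph} (W : OWalk A) (c : Fin A.1) (s : Bool)
    (hs : (s = true → A.2 (W.vert W.len) c) ∧ (s = false → A.2 c (W.vert W.len))) :
    ∃ W' : OWalk A, W'.vert 0 = W.vert 0 ∧ W'.vert W'.len = c ∧
      W'.netLength = W.netLength + sg s := by
  refine ⟨{ len := W.len + 1
            vert := fun k => if k ≤ W.len then W.vert k else c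
            sign := fun k => if k < W.len then W.sign k else s
            valid := ?_ }, ?_, ?_, ?_⟩
  · intro k hk
    rcases Nat.lt_succ_iff_lt_or_eq.1 hk with hl | he
    · have := W.valid k hl
      simpa [hl, hl.le, Nat.succ_le_of_lt hl] using this
    · subst he
      simpa using hs
  · simp
  · simp
  · rw [netLength_eq, netLength_eq]
    change ∑ k ∈ Finset.range (W.len + 1), sg (if k < W.len then W.sign k else s) = _
    rw [Finset.sum_range_succ, if_neg (lt_irrefl _)]
    congr 1
    refine Finset.sum_congr rfl fun k hk => ?_
    rw [if_pos (Finset.mem_range.1 hk)]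

theorem Reach.walk {A : FinDigraph} {a b : Fin A.1} {z : ℤ} (h : Reach A a b z) :
    ∃ W : OWalk A, W.vert 0 = a ∧ W.vert W.len = b ∧ W.netLength = z := by
  induction h with
  | nil =>
    exact ⟨⟨0, fun _ => a, fun _ => true, fun i hi => absurd hi (Nat.not_lt_zero i)⟩, rfl, rfl,
      by rw [netLength_eq]; simp⟩
  | @fwd b c z _ e ih =>
    obtain ⟨W, h0, h1, h2⟩ := ih
    obtain ⟨W', g0, g1, g2⟩ := snoc_walk W c true ⟨fun _ => h1 ▸ e, fun h => by simp at h⟩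
    exact ⟨W', g0.trans h0, g1, by rw [g2, h2]; simp [sg]⟩
  | @bwd b c z _ e ih =>
    obtain ⟨W, h0, h1, h2⟩ := ih
    obtain ⟨W', g0, g1, g2⟩ := snoc_walk W c false ⟨fun h => by simp at h, fun _ => h1 ▸ e⟩
    exact ⟨W', g0.trans h0, g1, by rw [g2, h2]; simp [sg]; ring⟩

theorem exists_potential (A : FinDigraph) (d : ℕ)
    (h : ∀ (a : Fin A.1) (z : ℤ), Reach A a a z → (d : ℤ) ∣ z) :
    ∃ g : Fin A.1 → ℤ, ∀ a b, A.2 a b → (d : ℤ) ∣ g b - (g a + 1) := by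
  let S : Setoid (Fin A.1) :=
    { r := fun a b => ∃ z, Reach A a b z
      iseqv := ⟨fun a => ⟨0, Reach.nil⟩, fun ⟨z, hz⟩ => ⟨-z, hz.symm⟩,
        fun ⟨y, hy⟩ ⟨z, hz⟩ => ⟨y + z, hy.trans hz⟩⟩ }
  have key : ∀ a : Fin A.1, ∃ z, Reach A (Quotient.out (Quotient.mk S a)) a z := fun a =>
    Quotient.exact (Quotient.out_eq (Quotient.mk S a))
  choose g hg using key
  refine ⟨g, fun a b e => ?_⟩
  have hab : Quotient.mk S a = Quotient.mk S b := Quotient.sound ⟨0 + 1, Reach.nil.fwd e⟩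
  have h1 := (hg a).fwd e
  have h2 := hg b
  rw [← hab] at h2
  have := h _ _ (h2.trans h1.symm)
  rwa [← sub_eq_add_neg] at this

theorem dvd_of_eq_rhs {a b c : ℤ} (h : b = c) (h2 : a ∣ b) : a ∣ c := h ▸ h2

theorem walk_hom {A : FinDigraph} (d : ℕ) (g : Fin A.1 → ℤ)
    (hg : ∀ a b, A.2 a b → (d : ℤ) ∣ g b - (g a + 1)) (W : OWalk A) :
    ∀ k ≤ W.len, (d : ℤ) ∣
      g (W.vert k) - g (W.vert 0) - ∑ i ∈ Finset.range k, sg (W.sign i) := by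
  intro k
  induction k with
  | zero => intro _; simp
  | succ k ih =>
    intro hk
    have h1 := ih (by omega)
    have h2 := W.valid k (by omega)
    rw [Finset.sum_range_succ]
    cases hs : W.sign k with
    | true =>
      have := dvd_add h1 (hg _ _ (h2.1 hs))
      have e : sg true = 1 := rfl
      rw [e]
      refine (dvd_of_eq_rhs ?_ this)
      ring
    | false =>
      have := dvd_sub h1 (hg _ _ (h2.2 hs))
      have e : sg false = -1 := rfl
      rw [e]
      refine (dvd_of_eq_rhs ?_ this)
      ring

/-- for `n, d ≥ 1` and a finite `n`-ary structure `A`, there is a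
homomorphism from `A` to the `n`-ary cycle `C_d^n` iff `d` divides `γ(A*)`. -/
theorem stmt10 (n d : ℕ) (hn : 1 ≤ n) (hd : 1 ≤ d) (A : NStruct n) :
    (∃ f : Fin A.1 → Fin (naryCycle n d).1, IsHomS A (naryCycle n d) f) ↔
      d ∣ gamma (star A) := by
  unfold gamma
  rw [dvd_setGcd_iff]
  constructor
  · rintro ⟨f, hf⟩ m ⟨hm, W, ⟨hl, hcl, -⟩, hW⟩
    have hg : ∀ a b : Fin A.1, (star A).2 a b →
        (d : ℤ) ∣ ((f b).val : ℤ) - (((f a).val : ℤ) + 1) := by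
      rintro a b ⟨t, i, hi, ht, rfl, rfl⟩
      obtain ⟨c, hc⟩ := hf t ht
      have h1 : (f (t i)).val = (c.val + i.val) % d := hc i
      have h2 : (f (t ⟨i.val + 1, hi⟩)).val = (c.val + (i.val + 1)) % d := hc ⟨i.val + 1, hi⟩
      rw [h1, h2]
      apply Int.ModEq.dvd
      push_cast
      have e1 : ((c.val : ℤ) + i.val) % d ≡ c.val + i.val [ZMOD d] := Int.mod_modEq _ _
      have e2 : ((c.val : ℤ) + (i.val + 1)) % d ≡ c.val + (i.val + 1) [ZMOD d] :=
        Int.mod_modEq _ _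
      refine (e1.add_right 1).trans ?_
      rw [add_assoc]
      exact e2.symm
    have := walk_hom (A := star A) d (fun a => ((f a).val : ℤ)) hg W W.len le_rfl
    rw [← netLength_eq, hcl, hW, sub_self, zero_sub, dvd_neg] at this
    exact Int.natCast_dvd_natCast.1 this
  · intro h
    obtain ⟨g, hg⟩ := exists_potential (star A) d (by
      intro a z hz
      obtain ⟨W, h0, h1, h2⟩ := hz.walk
      rw [← h2]
      exact closed_dvd d (fun m hm hW => h m ⟨hm, hW⟩) _ W rfl (h1.trans h0.symm))
    have hd0 : (0 : ℤ) < d := by exact_mod_cast hd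
    have hlt : ∀ a : Fin A.1, (g a % d).toNat < d := fun a => by
      have := Int.emod_lt_of_pos (g a) hd0
      have := Int.emod_nonneg (g a) hd0.ne'
      omega
    refine ⟨fun a => ⟨(g a % d).toNat, hlt a⟩, ?_⟩
    intro t ht
    refine ⟨⟨(g (t ⟨0, hn⟩) % d).toNat, hlt _⟩, ?_⟩
    have key : ∀ k (hk : k < n), g (t ⟨k, hk⟩) ≡ g (t ⟨0, hn⟩) + k [ZMOD d] := by
      intro k
      induction k with
      | zero => intro _; simp
      | succ k ih =>
        intro hk
        have h1 := ih (by omega)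
        have h2 := hg (t ⟨k, by omega⟩) (t ⟨k + 1, hk⟩) ⟨t, ⟨k, by omega⟩, hk, ht, rfl, rfl⟩
        have h3 := (Int.modEq_iff_dvd.2 h2).symm
        refine h3.trans ?_
        push_cast
        rw [← add_assoc]
        exact h1.add_right 1
    rintro ⟨k, hk⟩
    change (g (t ⟨k, hk⟩) % d).toNat = ((g (t ⟨0, hn⟩) % d).toNat + k) % d
    zify
    rw [Int.toNat_of_nonneg (Int.emod_nonneg _ hd0.ne'),
      Int.toNat_of_nonneg (Int.emod_nonneg _ hd0.ne'), Int.emod_add_emod]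
    exact key k hk
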